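/- Suppose ψ(3^n) ≤ 3^{-n} for all n ∈ ℕ. Then for all natural numbers n > m one has the quasi-independence inequality μ(A*_m ∩ A*_n) ≤ μ(A*_m) · μ(A*_n). -/

import Mathlib

/-!
Setting: `𝔽₃((X⁻¹))`, the field of formal Laurent series over the field `𝔽₃` with `3` elements,
with absolute value `|f| = 3^N` when `f = ∑_{n ≥ -N} a_{-n} X^{-n}` with `a_N ≠ 0`, `|0| = 0`.
We model it as `LaurentSeries (ZMod 3)` in the variable `t = X⁻¹`, so the coefficient
`a_{-n}` of `X^{-n}` is the coefficient of `t^n`, and `|f| = 3^{-ord_t f}`.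
-/

noncomputable section
open scoped ENNReal Classical

instance : Fact (Nat.Prime 3) := ⟨by norm_num⟩

/-- The field with three elements. -/
abbrev F3 := ZMod 3

/-- The field `𝔽₃((X⁻¹))`, modelled as Laurent series in `t = X⁻¹`. -/
abbrev L3 := LaurentSeries F3

/-- The element `X`, i.e. `t⁻¹`. -/
def XL : L3 := HahnSeries.single (-1 : ℤ) 1

/-- The absolute value: `|f| = 3^{-ord_t f}` for `f ≠ 0` and `|0| = 0`. -/
def absv (f : L3) : ℝ := if f = 0 then 0 else (3 : ℝ) ^ (-f.order)

/-- The ball of radius `r` around `x` for the ultrametric `d(x, y) = |x - y|`. -/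
def ball (x : L3) (r : ℝ) : Set L3 := {y | absv (y - x) < r}

/-- The unit ball `𝕀 = {h : |h| < 1}` around `0`. -/
def unitBall : Set L3 := ball 0 1

/-- The Cantor set `𝒞`: elements of `𝕀` all of whose coefficients `a_{-n}` lie in `{0, 2}`. -/
def Cantor : Set L3 :=
  {f | (∀ m : ℤ, m ≤ 0 → f.coeff m = 0) ∧ ∀ m : ℤ, 1 ≤ m → f.coeff m = 0 ∨ f.coeff m = 2}

/-- `γ = log 2 / log 3`. -/
def gam : ℝ := Real.log 2 / Real.log 3

/-- The Hausdorff `f`-measure of `A ⊆ 𝔽₃((X⁻¹))`, as defined in the paper: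
`ℋ^f(A) = lim_{ρ → 0} inf ∑ᵢ f(r(Bᵢ))`, the infimum being over countable covers of `A`
by balls `Bᵢ` with radius `r(Bᵢ) ≤ ρ`.  Every ball has radius `3^k` for some `k ∈ ℤ`;
a ball is recorded as a pair (centre, k).  (The `⨆` over `ρ` is the limit `ρ → 0`, the inner
infimum being antitone in `ρ`.) -/
def hmeas (f : ℝ → ℝ) (A : Set L3) : ℝ≥0∞ :=
  ⨆ (ρ : ℝ) (_ : 0 < ρ),
    ⨅ (S : Set (L3 × ℤ)) (_ : S.Countable)
      (_ : ∀ p ∈ S, (3 : ℝ) ^ p.2 ≤ ρ)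
      (_ : A ⊆ ⋃ p ∈ S, ball p.1 ((3 : ℝ) ^ p.2)),
      ∑' p : S, ENNReal.ofReal (f ((3 : ℝ) ^ (p : L3 × ℤ).2))

/-- The Hausdorff `γ`-measure `ℋ^γ`. -/
def hgamma (A : Set L3) : ℝ≥0∞ := hmeas (fun r => r ^ gam) A

/-- `μ(A) = ℋ^γ(A ∩ 𝒞)`. -/
def mu (A : Set L3) : ℝ≥0∞ := hgamma (A ∩ Cantor)

/-- A dimension function: a continuous, non-decreasing `f : ℝ_{≥0} → ℝ_{≥0}` with `f 0 = 0`. -/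
structure IsDimFun (f : ℝ → ℝ) : Prop where
  mono : MonotoneOn f (Set.Ici 0)
  cont : ContinuousOn f (Set.Ici 0)
  zero : f 0 = 0
  nonneg : ∀ r, 0 ≤ r → 0 ≤ f r

/-- The image of a polynomial `g ∈ 𝔽₃[X]` in `𝔽₃((X⁻¹))`. -/
def toL (g : Polynomial F3) : L3 := Polynomial.aeval XL g

/-- `ℱ(N)`: polynomials over `𝔽₃` of degree `< N`, all of whose coefficients
`a_0, …, a_{N-1}` lie in `{0, 2}`. -/
def Fset (N : ℕ) : Set (Polynomial F3) :=
  {g | g.degree < (N : ℕ) ∧ ∀ k < N, g.coeff k = 0 ∨ g.coeff k = 2}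

/-- `ℱ*(N)`: members of `ℱ(N)` with `g(0) = 2`. -/
def FsetStar (N : ℕ) : Set (Polynomial F3) :=
  {g | g.degree < (N : ℕ) ∧ (∀ k < N, g.coeff k = 0 ∨ g.coeff k = 2) ∧ g.coeff 0 = 2}

/-- `W_𝒞(ψ)`: elements `h ∈ 𝒞` with `|h - g/X^N| < ψ(3^N)` for infinitely many `N ∈ ℕ`,
where `g ∈ ℱ(N)`.  Here `ψ N` stands for `ψ(3^N)`. -/
def Wc (ψ : ℕ → ℝ) : Set L3 :=
  {h ∈ Cantor | ∀ m : ℕ, ∃ N : ℕ, m ≤ N ∧ 1 ≤ N ∧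
    ∃ g ∈ Fset N, absv (h - toL g / XL ^ N) < ψ N}

/-- `W*_𝒞(ψ)`: defined like `W_𝒞(ψ)`, with `ℱ*(N)` in place of `ℱ(N)`. -/
def WcStar (ψ : ℕ → ℝ) : Set L3 :=
  {h ∈ Cantor | ∀ m : ℕ, ∃ N : ℕ, m ≤ N ∧ 1 ≤ N ∧
    ∃ g ∈ FsetStar N, absv (h - toL g / XL ^ N) < ψ N}

/-- `A*_n = ⋃_{g ∈ ℱ*(n)} B(g/Xⁿ, ψ(3ⁿ))`. -/
def Astar (ψ : ℕ → ℝ) (n : ℕ) : Set L3 :=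
  ⋃ g ∈ FsetStar n, ball (toL g / XL ^ n) (ψ n)

/-- `𝒦(ψ)`: elements `ξ ∈ 𝕀` with `|ξ - g/h| < ψ(|h|)` for infinitely many fractions
`g/h ∈ 𝔽₃(X)`.  Here `ψ d` stands for `ψ(3^d)`, and `|h| = 3^{deg h}`. -/
def Kset (ψ : ℕ → ℝ) : Set L3 :=
  {ξ ∈ unitBall | {gh : Polynomial F3 × Polynomial F3 | gh.2 ≠ 0 ∧
    absv (ξ - toL gh.1 / toL gh.2) < ψ gh.2.natDegree}.Infinite}

/-- The irrationality exponent
`τ(ξ) = sup {τ : |ξ - g/h| < |h|^{-τ} for infinitely many g/h ∈ 𝔽₃(X)}`, valued in `[0, ∞]`. -/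
def irrExp (ξ : L3) : ℝ≥0∞ :=
  sSup {t : ℝ≥0∞ | ∃ τ : ℝ, t = ENNReal.ofReal τ ∧
    {gh : Polynomial F3 × Polynomial F3 | gh.2 ≠ 0 ∧
      absv (ξ - toL gh.1 / toL gh.2) < absv (toL gh.2) ^ (-τ)}.Infinite}

open MeasureTheory

/-- The point of the Cantor set with a prescribed sequence of digits: the coefficient of `X^{-n}`
is `2` exactly when `b (n - 1)` holds. -/
def cantorPoint (b : ℕ → Bool) : L3 :=
  HahnSeries.ofSuppBddBelow (fun j : ℤ => if 1 ≤ j ∧ b (j - 1).toNat then 2 else 0)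
    ⟨0, by
      intro j hj
      by_contra h
      exact hj (if_neg fun h' => h (by omega))⟩

theorem cantorPoint_coeff (b : ℕ → Bool) (j : ℤ) :
    (cantorPoint b).coeff j = if 1 ≤ j ∧ b (j - 1).toNat then 2 else 0 := rfl

theorem cantorPoint_coeff_succ (b : ℕ → Bool) (i : ℕ) :
    (cantorPoint b).coeff ((i : ℤ) + 1) = if b i then 2 else 0 := by
  rw [cantorPoint_coeff]
  simp

theorem cantorPoint_coeff_of_nonpos (b : ℕ → Bool) {j : ℤ} (hj : j ≤ 0) :
    (cantorPoint b).coeff j = 0 := by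
  rw [cantorPoint_coeff, if_neg (by omega)]

theorem F3.two_ne_zero : (2 : F3) ≠ 0 := by decide

theorem F3.ite_two_inj {b c : Bool} (h : (if b then (2 : F3) else 0) = if c then 2 else 0) :
    b = c := by
  cases b <;> cases c <;> first | rfl | exact absurd h (by decide)

theorem range_cantorPoint : Set.range cantorPoint = Cantor := by
  ext f
  constructor
  · rintro ⟨b, rfl⟩
    refine ⟨fun j hj => cantorPoint_coeff_of_nonpos b hj, fun j _ => ?_⟩
    rw [cantorPoint_coeff]
    split_ifs <;> simp
  · rintro ⟨h0, h1⟩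
    refine ⟨fun i => decide (f.coeff ((i : ℤ) + 1) = 2), ?_⟩
    ext j
    rcases le_or_gt j 0 with hj | hj
    · rw [cantorPoint_coeff_of_nonpos _ hj, h0 j hj]
    · obtain ⟨i, rfl⟩ : ∃ i : ℕ, j = (i : ℤ) + 1 := ⟨(j - 1).toNat, by omega⟩
      rw [cantorPoint_coeff_succ]
      rcases h1 _ hj with h | h
      · simp [h, F3.two_ne_zero.symm]
      · simp [h]

theorem absv_lt_zpow_iff (f : L3) (k : ℤ) :
    absv f < (3 : ℝ) ^ k ↔ ∀ j ≤ -k, f.coeff j = 0 := by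
  unfold absv
  split_ifs with h
  · simp only [h, HahnSeries.coeff_zero, implies_true, iff_true]
    positivity
  · rw [zpow_lt_zpow_iff_right₀ (by norm_num)]
    constructor
    · intro hk j hj
      exact HahnSeries.coeff_eq_zero_of_lt_order (by omega)
    · intro hj
      by_contra hk
      exact h (HahnSeries.coeff_order_eq_zero.1 (hj _ (by omega)))

theorem mem_ball_zpow_iff (x y : L3) (k : ℤ) :
    y ∈ ball x ((3 : ℝ) ^ k) ↔ ∀ j ≤ -k, y.coeff j = x.coeff j := by
  simp [ball, absv_lt_zpow_iff, sub_eq_zero]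

theorem cantorPoint_mem_ball_iff (b c : ℕ → Bool) (M : ℕ) :
    cantorPoint b ∈ ball (cantorPoint c) ((3 : ℝ) ^ (-(M : ℤ))) ↔ ∀ i < M, b i = c i := by
  rw [mem_ball_zpow_iff]
  constructor
  · intro h i hi
    have := h ((i : ℤ) + 1) (by omega)
    rw [cantorPoint_coeff_succ, cantorPoint_coeff_succ] at this
    exact F3.ite_two_inj this
  · intro h j hj
    rcases le_or_gt j 0 with hj' | hj'
    · rw [cantorPoint_coeff_of_nonpos _ hj', cantorPoint_coeff_of_nonpos _ hj']
    · obtain ⟨i, rfl⟩ : ∃ i : ℕ, j = (i : ℤ) + 1 := ⟨(j - 1).toNat, by omega⟩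
      rw [cantorPoint_coeff_succ, cantorPoint_coeff_succ, h i (by omega)]

/-- The fair coin-tossing measure on sequences of bits. -/
def coinMeasure : Measure (ℕ → Bool) :=
  Measure.infinitePi fun _ => (PMF.uniformOfFintype Bool).toMeasure

/-- The set of sequences of bits that agree with `a` on `F`. -/
def bitCylinder (F : Finset ℕ) (a : ℕ → Bool) : Set (ℕ → Bool) :=
  Set.pi F fun i => {a i}

theorem mem_bitCylinder {F : Finset ℕ} {a b : ℕ → Bool} :
    b ∈ bitCylinder F a ↔ ∀ i ∈ F, b i = a i := by
  simp [bitCylinder, Set.mem_pi]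

theorem measurableSet_bitCylinder (F : Finset ℕ) (a : ℕ → Bool) :
    MeasurableSet (bitCylinder F a) :=
  MeasurableSet.pi F.countable_toSet fun _ _ => measurableSet_singleton _

theorem coinMeasure_bitCylinder (F : Finset ℕ) (a : ℕ → Bool) :
    coinMeasure (bitCylinder F a) = 2⁻¹ ^ F.card := by
  rw [coinMeasure, bitCylinder, Measure.infinitePi_pi _ fun _ _ => measurableSet_singleton _]
  simp

theorem ofReal_zpow_gam (M : ℕ) :
    ENNReal.ofReal (((3 : ℝ) ^ (-(M : ℤ))) ^ gam) = 2⁻¹ ^ M := by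
  have h : (3 : ℝ) ^ gam = 2 := by
    simpa [gam, Real.logb] using Real.rpow_logb (b := 3) (x := 2) (by norm_num) (by norm_num)
      (by norm_num)
  rw [zpow_neg, zpow_natCast, Real.inv_rpow (by positivity), ← Real.rpow_natCast,
    ← Real.rpow_mul (by norm_num), mul_comm, Real.rpow_mul (by norm_num), h, Real.rpow_natCast,
    ENNReal.ofReal_inv_of_pos (by positivity), ENNReal.ofReal_pow (by norm_num), ENNReal.inv_pow]
  simp

theorem coinMeasure_preimage_le_hgamma (A : Set L3) :
    coinMeasure (cantorPoint ⁻¹' A) ≤ hgamma A := by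
  refine le_iSup₂_of_le (1 : ℝ) one_pos ?_
  refine le_iInf fun S => le_iInf fun hS => le_iInf fun hρ => le_iInf fun hA => ?_
  calc coinMeasure (cantorPoint ⁻¹' A)
      ≤ coinMeasure (⋃ p ∈ S, cantorPoint ⁻¹' ball p.1 ((3 : ℝ) ^ p.2)) := by
        refine measure_mono ?_
        simpa only [Set.preimage_iUnion] using Set.preimage_mono (f := cantorPoint) hA
    _ ≤ ∑' p : S, coinMeasure (cantorPoint ⁻¹' ball p.1.1 ((3 : ℝ) ^ p.1.2)) :=
        measure_biUnion_le _ hS _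
    _ ≤ _ := ENNReal.tsum_le_tsum fun p => ?_
  obtain ⟨⟨x, k⟩, hp⟩ := p
  have hk : k ≤ 0 := by
    have := hρ _ hp
    rwa [← zpow_zero (3 : ℝ), zpow_le_zpow_iff_right₀ (by norm_num)] at this
  obtain ⟨M, rfl⟩ : ∃ M : ℕ, k = -(M : ℤ) := ⟨(-k).toNat, by omega⟩
  dsimp only
  rw [ofReal_zpow_gam]
  rcases (cantorPoint ⁻¹' ball x ((3 : ℝ) ^ (-(M : ℤ)))).eq_empty_or_nonempty with h | ⟨c, hc⟩
  · rw [h, measure_empty]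
    exact zero_le
  · calc _ ≤ coinMeasure (bitCylinder (Finset.range M) c) := by
          refine measure_mono fun b hb => mem_bitCylinder.2 fun i hi => ?_
          rw [Set.mem_preimage, mem_ball_zpow_iff] at hb hc
          exact (cantorPoint_mem_ball_iff b c M).1
            ((mem_ball_zpow_iff _ _ _).2 fun j hj => (hb j hj).trans (hc j hj).symm) i
            (Finset.mem_range.1 hi)
      _ = 2⁻¹ ^ M := by simp [coinMeasure_bitCylinder]

theorem hgamma_image_bitCylinder_le (F : Finset ℕ) (a : ℕ → Bool) :
    hgamma (cantorPoint '' bitCylinder F a) ≤ coinMeasure (bitCylinder F a) := by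
  refine iSup₂_le fun ρ hρ => ?_
  obtain ⟨M₀, hM₀⟩ := exists_pow_lt_of_lt_one hρ (show (3⁻¹ : ℝ) < 1 by norm_num)
  obtain ⟨M, hFM, hM₀M⟩ : ∃ M, F ⊆ Finset.range M ∧ M₀ ≤ M := by
    obtain ⟨M₁, h⟩ := F.exists_nat_subset_range
    exact ⟨max M₁ M₀, h.trans (Finset.range_mono (le_max_left _ _)), le_max_right _ _⟩
  have hMρ : (3 : ℝ) ^ (-(M : ℤ)) ≤ ρ := by
    rw [zpow_neg, zpow_natCast, ← inv_pow]
    exact (pow_le_pow_of_le_one (by norm_num) (by norm_num) hM₀M).trans hM₀.le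
  let ext (c : Fin M → Bool) (i : ℕ) : Bool := if h : i < M then c ⟨i, h⟩ else false
  have hext (c : Fin M → Bool) {i : ℕ} (h : i < M) : ext c i = c ⟨i, h⟩ := dif_pos h
  let T : Type := {c : Fin M → Bool // ext c ∈ bitCylinder F a}
  let centre (c : T) : L3 × ℤ := (cantorPoint (ext c.1), -(M : ℤ))
  refine iInf_le_of_le (Set.range centre) <| iInf_le_of_le (Set.countable_range _) <|
    iInf_le_of_le ?_ <| iInf_le_of_le ?_ ?_
  · rintro _ ⟨c, rfl⟩
    exact hMρ
  · rintro _ ⟨b, hb, rfl⟩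
    have hbe : ∀ i < M, b i = ext (fun i => b i) i := fun i hi => (hext (fun i => b i) hi).symm
    have hT : ext (fun i => b i) ∈ bitCylinder F a := mem_bitCylinder.2 fun i hi =>
      (hbe i (Finset.mem_range.1 (hFM hi))).symm.trans (mem_bitCylinder.1 hb i hi)
    exact Set.mem_iUnion₂.2 ⟨centre ⟨fun i => b i, hT⟩, Set.mem_range_self _,
      (cantorPoint_mem_ball_iff _ _ _).2 hbe⟩
  · calc _ ≤ ∑' c : T, ENNReal.ofReal (((3 : ℝ) ^ (centre c).2) ^ gam) :=
          ENNReal.tsum_le_tsum_comp_of_surjective Set.rangeFactorization_surjective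
            fun p : Set.range centre => ENNReal.ofReal (((3 : ℝ) ^ p.1.2) ^ gam)
      _ = ∑' c : T, coinMeasure (bitCylinder (Finset.range M) (ext c.1)) := by
          simp [centre, coinMeasure_bitCylinder, ofReal_zpow_gam, -zpow_neg, -zpow_natCast]
      _ ≤ coinMeasure (⋃ c : T, bitCylinder (Finset.range M) (ext c.1)) := by
          refine tsum_meas_le_meas_iUnion_of_disjoint _
            (fun c => measurableSet_bitCylinder _ _) fun c d hcd => ?_
          refine Set.disjoint_left.2 fun b hc hd => hcd (Subtype.ext (funext fun i => ?_))
          have hi := Finset.mem_range.2 i.2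
          rw [← hext c.1 i.2, ← hext d.1 i.2, ← mem_bitCylinder.1 hc i hi,
            ← mem_bitCylinder.1 hd i hi]
      _ ≤ _ := by
          refine measure_mono (Set.iUnion_subset fun c b hb => mem_bitCylinder.2 fun i hi => ?_)
          exact (mem_bitCylinder.1 hb i (hFM hi)).trans (mem_bitCylinder.1 c.2 i hi)

theorem mu_eq_of_preimage_eq_bitCylinder {A : Set L3} {F : Finset ℕ} {a : ℕ → Bool}
    (h : cantorPoint ⁻¹' A = bitCylinder F a) : mu A = 2⁻¹ ^ F.card := by
  have hA : A ∩ Cantor = cantorPoint '' bitCylinder F a := by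
    rw [← h, Set.image_preimage_eq_inter_range, range_cantorPoint]
  refine le_antisymm ?_ ?_
  · rw [mu, hA, ← coinMeasure_bitCylinder F a]
    exact hgamma_image_bitCylinder_le F a
  · have := coinMeasure_preimage_le_hgamma (A ∩ Cantor)
    rwa [← range_cantorPoint, Set.preimage_inter_range, h, coinMeasure_bitCylinder,
      range_cantorPoint] at this

theorem mu_eq_zero_of_preimage_eq_empty {A : Set L3} (h : cantorPoint ⁻¹' A = ∅) : mu A = 0 := by
  have hA : A ∩ Cantor = ∅ := by
    rw [← range_cantorPoint, ← Set.image_preimage_eq_inter_range, h, Set.image_empty]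
  rw [mu, hA, hgamma, hmeas]
  refine le_antisymm (iSup₂_le fun ρ _ => ?_) zero_le
  refine iInf_le_of_le ∅ <| iInf_le_of_le Set.countable_empty <|
    iInf_le_of_le (by simp) <| iInf_le_of_le (by simp) ?_
  simp

theorem XL_pow (n : ℕ) : XL ^ n = HahnSeries.single (-(n : ℤ)) (1 : F3) := by
  simp [XL, HahnSeries.single_pow]

theorem F3.algebraMap_apply (c : F3) : algebraMap F3 L3 c = HahnSeries.C c := by
  simp [HahnSeries.algebraMap_apply']

theorem toL_coeff (g : Polynomial F3) (j : ℤ) :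
    (toL g).coeff j = if j ≤ 0 then g.coeff (-j).toNat else 0 := by
  induction g using Polynomial.induction_on' with
  | add p q hp hq =>
    simp only [toL, map_add, HahnSeries.coeff_add, Polynomial.coeff_add] at hp hq ⊢
    rw [hp, hq]
    split_ifs <;> simp
  | monomial k c =>
    rw [toL, Polynomial.aeval_monomial, XL_pow, F3.algebraMap_apply, HahnSeries.C_mul_eq_smul,
      HahnSeries.coeff_smul, HahnSeries.coeff_single, Polynomial.coeff_monomial]
    split_ifs <;> first | omega | simp

theorem toL_div_XL_pow_coeff (g : Polynomial F3) (n : ℕ) (j : ℤ) :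
    (toL g / XL ^ n).coeff j = if j ≤ n then g.coeff (n - j).toNat else 0 := by
  have h : toL g / XL ^ n = toL g * HahnSeries.single (n : ℤ) 1 := by
    rw [div_eq_mul_inv, XL_pow, HahnSeries.inv_single, neg_neg, inv_one]
  have hj : j = (j - n) + n := by ring
  rw [h, hj, HahnSeries.coeff_mul_single_add, mul_one, toL_coeff, ← hj]
  simp

theorem cantorPoint_preimage_Astar {ψ : ℕ → ℝ} {n r : ℕ} (hn : 1 ≤ n) (hr : n ≤ r)
    (hψ : ψ n = (3 : ℝ) ^ (-(r : ℤ))) :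
    cantorPoint ⁻¹' Astar ψ n = bitCylinder (Finset.Ico (n - 1) r) fun i => decide (i = n - 1) := by
  ext b
  simp only [Astar, hψ, Set.mem_preimage, Set.mem_iUnion, mem_ball_zpow_iff, exists_prop,
    neg_neg, toL_div_XL_pow_coeff, mem_bitCylinder, Finset.mem_Ico]
  constructor
  · rintro ⟨g, ⟨-, -, hg0⟩, hb⟩ i ⟨hi, hir⟩
    have := hb ((i : ℤ) + 1) (by omega)
    rw [cantorPoint_coeff_succ] at this
    refine F3.ite_two_inj (this.trans ?_)
    rcases hi.eq_or_lt with rfl | hi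
    · have : ((n : ℤ) - (((n - 1 : ℕ) : ℤ) + 1)).toNat = 0 := by omega
      rw [this, hg0, if_pos (by omega)]
      simp
    · rw [if_neg (by omega)]
      simp [show i ≠ n - 1 by omega]
  · intro hb
    let g : Polynomial F3 :=
      ∑ k ∈ Finset.range n, Polynomial.monomial k (if b (n - 1 - k) then (2 : F3) else 0)
    have hg (k : ℕ) : g.coeff k = if k < n then (if b (n - 1 - k) then (2 : F3) else 0) else 0 := by
      simp [g, Polynomial.coeff_monomial]
    refine ⟨g, ⟨?_, ?_, ?_⟩, ?_⟩
    · rw [Polynomial.degree_lt_iff_coeff_zero]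
      intro k hk
      rw [hg, if_neg (by omega)]
    · intro k hk
      rw [hg, if_pos hk]
      split_ifs <;> simp
    · rw [hg, if_pos (by omega), hb _ (by omega)]
      simp
    · intro j hj
      rcases le_or_gt j 0 with hj' | hj'
      · rw [cantorPoint_coeff_of_nonpos _ hj', hg, if_neg (by omega : ¬ (n - j).toNat < n)]
        simp
      · obtain ⟨i, rfl⟩ : ∃ i : ℕ, j = (i : ℤ) + 1 := ⟨(j - 1).toNat, by omega⟩
        rw [cantorPoint_coeff_succ, hg]
        by_cases hi : i < n
        · rw [if_pos (show (i : ℤ) + 1 ≤ n by omega),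
            if_pos (show ((n : ℤ) - (i + 1)).toNat < n by omega)]
          congr 3
          omega
        · rw [if_neg (show ¬ (i : ℤ) + 1 ≤ n by omega), hb i (by omega)]
          simp [show i ≠ n - 1 by omega]

/-- quasi-independence.  Assume `ψ(3^n) ≤ 3^{-n}` for all `n`.
Then for `n > m` one has `μ(A*_m ∩ A*_n) ≤ μ(A*_m) · μ(A*_n)`. -/
theorem quasi_independence (ψ : ℕ → ℝ)
    (hψ : ∀ n : ℕ, 1 ≤ n → ∃ r : ℤ, ψ n = (3 : ℝ) ^ (-r))
    (hle : ∀ n : ℕ, 1 ≤ n → ψ n ≤ (3 : ℝ) ^ (-(n : ℤ)))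
    (m n : ℕ) (hm : 1 ≤ m) (hmn : m < n) :
    mu (Astar ψ m ∩ Astar ψ n) ≤ mu (Astar ψ m) * mu (Astar ψ n) := by
  have key : ∀ k : ℕ, 1 ≤ k → ∃ r : ℕ, k ≤ r ∧ ψ k = (3 : ℝ) ^ (-(r : ℤ)) := by
    intro k hk
    obtain ⟨r, hr⟩ := hψ k hk
    have h := hle k hk
    rw [hr, zpow_le_zpow_iff_right₀ (by norm_num)] at h
    refine ⟨r.toNat, by omega, ?_⟩
    rw [hr, Int.toNat_of_nonneg (by omega)]
  obtain ⟨s, hms, hs⟩ := key m hm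
  obtain ⟨r, hnr, hr⟩ := key n (by omega)
  have hA := cantorPoint_preimage_Astar hm hms hs
  have hB := cantorPoint_preimage_Astar (by omega) hnr hr
  rcases lt_or_ge s n with hsn | hns
  · have hAB : cantorPoint ⁻¹' (Astar ψ m ∩ Astar ψ n) =
        bitCylinder (Finset.Ico (m - 1) s ∪ Finset.Ico (n - 1) r)
          fun i => decide (i = m - 1 ∨ i = n - 1) := by
      rw [Set.preimage_inter, hA, hB]
      ext b
      simp only [Set.mem_inter_iff, mem_bitCylinder, Finset.mem_union, or_imp, forall_and]
      refine and_congr (forall₂_congr fun i hi => ?_) (forall₂_congr fun i hi => ?_) <;>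
        rw [Finset.mem_Ico] at hi
      · simp [show i ≠ n - 1 by omega]
      · simp [show i ≠ m - 1 by omega]
    have hdisj : Disjoint (Finset.Ico (m - 1) s) (Finset.Ico (n - 1) r) := by
      refine Finset.disjoint_left.2 fun i hi hi' => ?_
      rw [Finset.mem_Ico] at hi hi'
      omega
    rw [mu_eq_of_preimage_eq_bitCylinder hA, mu_eq_of_preimage_eq_bitCylinder hB,
      mu_eq_of_preimage_eq_bitCylinder hAB, Finset.card_union_of_disjoint hdisj, pow_add]
  · have hAB : cantorPoint ⁻¹' (Astar ψ m ∩ Astar ψ n) = ∅ := by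
      rw [Set.preimage_inter, hA, hB]
      refine Set.eq_empty_of_forall_notMem fun b ⟨hb, hb'⟩ => ?_
      have h := mem_bitCylinder.1 hb (n - 1) (Finset.mem_Ico.2 (by omega))
      have h' := mem_bitCylinder.1 hb' (n - 1) (Finset.mem_Ico.2 (by omega))
      rw [h'] at h
      simp at h
      omega
    rw [mu_eq_zero_of_preimage_eq_empty hAB]
    exact zero_le
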